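/- Let f₀ be a FISI polynomial of degree d ≥ 2 and let P be a one-parameter deformation of f₀ such that W₀ ∩ {φ_d = 0} = ∅. Then there exists ε > 0 such that for all s with 0 < |s| < ε and all t ∈ ℂ: the projective closure Y_{s,t} of f_s^{-1}(t) has no singular point on the hyperplane at infinity H^∞, and the projective hypersurface Y^∞_{s,t} = {P_d(·,s) = 0} ⊂ ℙ^{n−1} is nonsingular; equivalently, Σ_s = ∅ and W_s = ∅ for all 0 < |s| < ε. -/

import Mathlib

open MvPolynomial Filter CategoryTheory Limits Topology

noncomputable section

abbrev XS (n : ℕ) := Fin n ⊕ Unit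
abbrev HV (n : ℕ) := Fin n ⊕ Unit
abbrev TV (n : ℕ) := Fin n ⊕ Fin 3

/-- ℙ^{n-1}, the hyperplane at infinity of ℙⁿ. -/
abbrev PrjInf (n : ℕ) := Projectivization ℂ (Fin n → ℂ)
/-- ℙⁿ. -/
abbrev Prj (n : ℕ) := Projectivization ℂ (HV n → ℂ)

/-- weights for the degree in the `x`-variables only: `s` has weight `0`. -/
def wtx (n : ℕ) : XS n → ℕ := Sum.elim (fun _ => 1) (fun _ => 0)

/-- `P_q`, the degree-`q` homogeneous part of `P` in the variables `x`. -/
def xpart {n : ℕ} (P : MvPolynomial (XS n) ℂ) (q : ℕ) : MvPolynomial (XS n) ℂ :=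
  weightedHomogeneousComponent (wtx n) q P

/-- the evaluation point `(x, s)`. -/
def evA {n : ℕ} (x : Fin n → ℂ) (s : ℂ) : XS n → ℂ := Sum.elim x (fun _ => s)

/-- `deg_x P(·,s) = d` at the parameter value `s`. -/
def DegXAt {n : ℕ} (d : ℕ) (P : MvPolynomial (XS n) ℂ) (s : ℂ) : Prop :=
  (∀ q, d < q → ∀ x : Fin n → ℂ, eval (evA x s) (xpart P q) = 0) ∧
  (∃ x : Fin n → ℂ, eval (evA x s) (xpart P d) ≠ 0)

/-- the substitution embedding the variables `(x,s)` into the variables `(x,x₀,s,t)`. -/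
def embT {n : ℕ} : XS n → MvPolynomial (TV n) ℂ :=
  Sum.elim (fun i => X (Sum.inl i)) (fun _ => X (Sum.inr 1))

/-- The defining polynomial `F = P̃(x,x₀,s) - t·x₀^d` of the total space
`Y ⊂ ℙⁿ × ℂ_s × ℂ_t`, where `P̃ = Σ_{q ≤ d} x₀^{d-q} P_q(x,s)` is the homogenization
of `P` in `x` by the variable `x₀`. -/
def FY {n : ℕ} (d : ℕ) (P : MvPolynomial (XS n) ℂ) : MvPolynomial (TV n) ℂ :=
  (∑ q ∈ Finset.range (d+1), (X (Sum.inr 0))^(d-q) * aeval embT (xpart P q))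
    - X (Sum.inr 2) * (X (Sum.inr 0))^d

/-- the evaluation point `((x,x₀), s, t)` of the variables of `FY`. -/
def evT {n : ℕ} (u : HV n → ℂ) (s t : ℂ) : TV n → ℂ :=
  Sum.elim (fun i => u (Sum.inl i)) ![u (Sum.inr ()), s, t]

/-- `([u], s, t) ∈ Y`. -/
def OnY {n : ℕ} (d : ℕ) (P : MvPolynomial (XS n) ℂ) (u : HV n → ℂ) (s t : ℂ) : Prop :=
  eval (evT u s t) (FY d P) = 0

/-- all partial derivatives of the defining equation of `Y` — with respect to the
homogeneous coordinates `(x, x₀)` and the affine coordinates `s, t` — vanish at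
`([u], s, t)`; together with `OnY` this says `([u],s,t)` is a singular point of `Y`. -/
def AllDerivsVanish {n : ℕ} (d : ℕ) (P : MvPolynomial (XS n) ℂ) (u : HV n → ℂ)
    (s t : ℂ) : Prop :=
  ∀ v : TV n, eval (evT u s t) (pderiv v (FY d P)) = 0

/-- the partial derivatives with respect to the homogeneous coordinates `(x, x₀)`
vanish at `([u], s, t)`; together with `OnY` this says `[u]` is a singular point of the
projective fiber `Y_{s,t}`. -/
def FiberDerivsVanish {n : ℕ} (d : ℕ) (P : MvPolynomial (XS n) ℂ) (u : HV n → ℂ)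
    (s t : ℂ) : Prop :=
  (∀ i : Fin n, eval (evT u s t) (pderiv (Sum.inl i) (FY d P)) = 0) ∧
    eval (evT u s t) (pderiv (Sum.inr 0) (FY d P)) = 0

/-- the partial derivatives with respect to `(x, x₀)` and `t` (but not `s`) vanish;
together with `OnY` this identifies the singular points of `Y_{s,ℂ}`, resp. the critical
points of the projection `σ : Y → ℂ_s`. -/
def SliceDerivsVanish {n : ℕ} (d : ℕ) (P : MvPolynomial (XS n) ℂ) (u : HV n → ℂ)
    (s t : ℂ) : Prop :=
  FiberDerivsVanish d P u s t ∧ eval (evT u s t) (pderiv (Sum.inr 2) (FY d P)) = 0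

/-- `[x] ∈ W_s`: all `∂P_d/∂x_i` vanish at `(x,s)`. -/
def WCond {n : ℕ} (d : ℕ) (P : MvPolynomial (XS n) ℂ) (x : Fin n → ℂ) (s : ℂ) : Prop :=
  ∀ i : Fin n, eval (evA x s) (pderiv (Sum.inl i) (xpart P d)) = 0

/-- `[x] ∈ Σ_s`: moreover `P_{d-1}(x,s) = 0`. -/
def SCond {n : ℕ} (d : ℕ) (P : MvPolynomial (XS n) ℂ) (x : Fin n → ℂ) (s : ℂ) : Prop :=
  WCond d P x s ∧ eval (evA x s) (xpart P (d-1)) = 0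

/-- `φ_d(x) = ∂P_d/∂s (x, 0) = 0`. -/
def PhiCond {n : ℕ} (d : ℕ) (P : MvPolynomial (XS n) ℂ) (x : Fin n → ℂ) : Prop :=
  eval (evA x 0) (pderiv (Sum.inr ()) (xpart P d)) = 0

/-- `W_s ⊂ ℙ^{n-1}` as a set of projective points. -/
def Wset {n : ℕ} (d : ℕ) (P : MvPolynomial (XS n) ℂ) (s : ℂ) : Set (PrjInf n) :=
  {p | WCond d P p.rep s}

/-- `Σ_s ⊂ ℙ^{n-1}` as a set of projective points. -/
def Sigset {n : ℕ} (d : ℕ) (P : MvPolynomial (XS n) ℂ) (s : ℂ) : Set (PrjInf n) :=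
  {p | SCond d P p.rep s}

/-- `f_s = P(·,s)` as a polynomial in `x`. -/
def fS {n : ℕ} (P : MvPolynomial (XS n) ℂ) (s : ℂ) : MvPolynomial (Fin n) ℂ :=
  aeval (Sum.elim X (fun _ => C s)) P

/-- `x` is an affine critical point of `f_s`, i.e. `∂P/∂x_i(x,s) = 0` for all `i`. -/
def CritPt {n : ℕ} (P : MvPolynomial (XS n) ℂ) (x : Fin n → ℂ) (s : ℂ) : Prop :=
  ∀ i : Fin n, eval (evA x s) (pderiv (Sum.inl i) P) = 0

/-- the set of singular points of the compactified fiber `Y_{s,t} ⊂ ℙⁿ`. -/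
def SingYst {n : ℕ} (d : ℕ) (P : MvPolynomial (XS n) ℂ) (s t : ℂ) : Set (Prj n) :=
  {p | OnY d P p.rep s t ∧ FiberDerivsVanish d P p.rep s t}

/-- `f₀ = P(·,0)` is a FISI polynomial: it has finitely many critical points, the
projective closure of each of its fibers has only isolated (= finitely many) singular
points, and the singular locus `W₀` of the slice at infinity is finite. -/
def FISIat {n : ℕ} (d : ℕ) (P : MvPolynomial (XS n) ℂ) (s : ℂ) : Prop :=
  {x : Fin n → ℂ | CritPt P x s}.Finite ∧ (∀ t : ℂ, (SingYst d P s t).Finite) ∧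
    (Wset d P s).Finite

/-- `P` is a FISI deformation: `f₀` is FISI, `W₀` is finite and every `f_s`, for `s` in a
neighbourhood of `0`, has only finitely many critical points. -/
def FISIdef {n : ℕ} (d : ℕ) (P : MvPolynomial (XS n) ℂ) : Prop :=
  FISIat d P 0 ∧ ∃ ε > (0:ℝ), ∀ s : ℂ, ‖s‖ < ε → {x : Fin n → ℂ | CritPt P x s}.Finite

/-- The "Milnor-type" local dimension: given polynomial germs `gs` at a point `a ∈ ℂᵐ`,
this is the `ℂ`-dimension of the formal power series ring at `a` (identified with
`ℂ[[X]]` via `X ↦ X - a`) modulo the ideal generated by the germs. -/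
def germDim {m : ℕ} (gs : Set (MvPolynomial (Fin m) ℂ)) (a : Fin m → ℂ) : ℕ :=
  Module.finrank ℂ (MvPowerSeries (Fin m) ℂ ⧸ Ideal.span
    ((fun g => (MvPolynomial.coeToMvPowerSeries.ringHom
        (aeval (fun i => X i + C (a i)) g) : MvPowerSeries (Fin m) ℂ)) '' gs))

/-- the (choice of an) index `j` with `p.rep j ≠ 0`, used to normalize `v_j = 1`
and to work in the chart `x_j = 1` of `ℙⁿ`. -/
def jp {n : ℕ} (p : PrjInf n) : Fin n :=
  (Function.ne_iff.mp p.rep_nonzero).choose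

lemma jp_spec {n : ℕ} (p : PrjInf n) : p.rep (jp p) ≠ 0 :=
  (Function.ne_iff.mp p.rep_nonzero).choose_spec

/-- the chart coordinates of the point at infinity `p = [v:0]`, where `v` is normalized
by `v_{j(p)} = 1`, in the chart `x_{j(p)} = 1` of `ℙⁿ`; the slot `j(p)` of the chart
carries the coordinate `x₀`, which is `0` at `p`. -/
def chartPt {n : ℕ} (p : PrjInf n) : Fin n → ℂ :=
  fun i => if i = jp p then 0 else p.rep i / p.rep (jp p)

/-- the chart equation of the compactified fiber `Y_{s,t}` in the chart `x_j = 1` of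
`ℙⁿ`: substitute `x_j = 1` in the homogeneous defining equation `FY`, the chart slot `j`
carrying the coordinate `x₀`. -/
def chartEq {n : ℕ} (d : ℕ) (P : MvPolynomial (XS n) ℂ) (j : Fin n) (s t : ℂ) :
    MvPolynomial (Fin n) ℂ :=
  aeval (Sum.elim (fun i => if i = j then 1 else X i) ![X j, C s, C t]) (FY d P)

/-- the chart equation of the hypersurface `{P_d(·,s) = 0} ⊂ ℙ^{n-1}` in the chart
`x_j = 1` of `ℙ^{n-1}` (the chart variable `X j` is unused). -/
def chartEqInf {n : ℕ} (d : ℕ) (P : MvPolynomial (XS n) ℂ) (j : Fin n) (s : ℂ) :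
    MvPolynomial (Fin n) ℂ :=
  aeval (fun i => if i = j then 1 else X i) (aeval (Sum.elim X (fun _ => C s)) (xpart P d))

/-- `μ_p(t,s)`, the Milnor number of the isolated singularity of the compactified fiber
`Y_{s,t}` at the point `p` of the hyperplane at infinity. -/
def muP {n : ℕ} (d : ℕ) (P : MvPolynomial (XS n) ℂ) (p : PrjInf n) (s t : ℂ) : ℕ :=
  germDim (Set.range fun i => pderiv i (chartEq d P (jp p) s t)) (chartPt p)

/-- `μ_{p,gen}(s) = min_{t ∈ ℂ} μ_p(t,s)`. -/
def muGen {n : ℕ} (d : ℕ) (P : MvPolynomial (XS n) ℂ) (p : PrjInf n) (s : ℂ) : ℕ :=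
  sInf (Set.range (muP d P p s))

/-- the local Milnor–Lê number `λ_{p,t}(s) = μ_p(t,s) − μ_{p,gen}(s)`. -/
def lamP {n : ℕ} (d : ℕ) (P : MvPolynomial (XS n) ℂ) (p : PrjInf n) (t s : ℂ) : ℕ :=
  muP d P p s t - muGen d P p s

/-- `μ_p^∞(s)`, the Milnor number at `p` of the hypersurface `{P_d(·,s)=0} ⊂ ℙ^{n-1}`:
computed in the chart `x_{j(p)} = 1`, adding the generator `X (j p)` to kill the unused
chart variable. -/
def muInf {n : ℕ} (d : ℕ) (P : MvPolynomial (XS n) ℂ) (p : PrjInf n) (s : ℂ) : ℕ :=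
  germDim ({g | ∃ i, i ≠ jp p ∧ g = pderiv i (chartEqInf d P (jp p) s)} ∪ {X (jp p)})
    (chartPt p)

/-- the total Milnor number `μ(s)` of the affine singularities of `f_s`. -/
def muTot {n : ℕ} (P : MvPolynomial (XS n) ℂ) (s : ℂ) : ℕ :=
  Module.finrank ℂ (MvPolynomial (Fin n) ℂ ⧸
    Ideal.span (Set.range fun i => pderiv i (fS P s)))

/-- the local Milnor number `μ_a(f_s)` of `f_s` at the point `a ∈ ℂⁿ`. -/
def muAt {n : ℕ} (P : MvPolynomial (XS n) ℂ) (s : ℂ) (a : Fin n → ℂ) : ℕ :=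
  germDim (Set.range fun i => pderiv i (fS P s)) a

/-- the total Milnor–Lê number at infinity `λ(s) = Σ_{p ∈ Σ_s} Σ_{t ∈ ℂ} λ_{p,t}(s)`
(all but finitely many summands vanish). -/
def lamTot {n : ℕ} (d : ℕ) (P : MvPolynomial (XS n) ℂ) (s : ℂ) : ℕ :=
  ∑ᶠ p ∈ Sigset d P s, ∑ᶠ t : ℂ, lamP d P p t s

/-- the chart coordinates of the affine point `[x : 1] ∈ ℙⁿ` in the chart `x_j = 1`,
the slot `j` carrying the coordinate `x₀` (i.e. `1/x_j`). -/
def chartCo {n : ℕ} (j : Fin n) (x : Fin n → ℂ) : Fin n → ℂ :=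
  fun i => if i = j then 1 / x j else x i / x j

/-- the affine discriminant `Δ_P ⊂ ℂ_s × ℂ_t`: the closure of the set of pairs
`(s, f_s(x))` over the affine critical points `x` of `f_s`. -/
def DeltaP {n : ℕ} (P : MvPolynomial (XS n) ℂ) : Set (ℂ × ℂ) :=
  closure {w : ℂ × ℂ | ∃ x : Fin n → ℂ, CritPt P x w.1 ∧ w.2 = eval (evA x w.1) P}

section AuxProof

/-- Over `ℂ`, an element of a finitely generated field with zero differential is algebraic. -/
lemma isAlgebraic_of_D_eq_zero {K : Type} [Field K] [Algebra ℂ K] [Algebra.EssFiniteType ℂ K]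
    (s : K) (hs : KaehlerDifferential.D ℂ K s = 0) : IsAlgebraic ℂ s := by
  by_contra htr
  have htr : Transcendental ℂ s := htr
  let alg : Algebra (Polynomial ℂ) K := (Polynomial.aeval s).toRingHom.toAlgebra
  have hmap : ∀ p : Polynomial ℂ, algebraMap (Polynomial ℂ) K p = Polynomial.aeval s p :=
    fun p => rfl
  have : IsScalarTower ℂ (Polynomial ℂ) K := IsScalarTower.of_algebraMap_eq fun c => by
    rw [hmap]; simp
  have hinj : Function.Injective (algebraMap (Polynomial ℂ) K) :=
    transcendental_iff_injective.mp htr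
  have : FaithfulSMul (Polynomial ℂ) K := (faithfulSMul_iff_algebraMap_injective _ _).mpr hinj
  let : Algebra (FractionRing (Polynomial ℂ)) K := FractionRing.liftAlgebra _ _
  have : IsScalarTower (Polynomial ℂ) (FractionRing (Polynomial ℂ)) K :=
    FractionRing.isScalarTower_liftAlgebra _ _
  have : Algebra.EssFiniteType (Polynomial ℂ) K := Algebra.EssFiniteType.of_comp ℂ _ _
  have : Algebra.EssFiniteType (FractionRing (Polynomial ℂ)) K :=
    Algebra.EssFiniteType.of_comp (Polynomial ℂ) _ _
  have : CharZero (FractionRing (Polynomial ℂ)) := inferInstance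
  have : PerfectField (FractionRing (Polynomial ℂ)) := inferInstance
  have h1 : Algebra.FormallySmooth (FractionRing (Polynomial ℂ)) K := inferInstance
  have h2 : Algebra.FormallySmooth (Polynomial ℂ) (FractionRing (Polynomial ℂ)) :=
    .of_isLocalization (nonZeroDivisors _)
  have h3 : Algebra.FormallySmooth (Polynomial ℂ) K :=
    .comp _ (FractionRing (Polynomial ℂ)) _
  have hex := Algebra.H1Cotangent.exact_δ_mapBaseChange ℂ (Polynomial ℂ) K
  have h0 : KaehlerDifferential.mapBaseChange ℂ (Polynomial ℂ) K
      (1 ⊗ₜ KaehlerDifferential.D ℂ (Polynomial ℂ) Polynomial.X) = 0 := by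
    rw [KaehlerDifferential.mapBaseChange_tmul, KaehlerDifferential.map_D, hmap]
    simp [hs]
  obtain ⟨y, hy⟩ := (hex _).mp h0
  rw [Subsingleton.elim y 0, map_zero] at hy
  have h4 := congrArg (fun z => TensorProduct.rid (Polynomial ℂ) K
    (LinearMap.lTensor K (KaehlerDifferential.polynomialEquiv ℂ).toLinearMap z)) hy
  simp at h4

lemma derivation_expand {σ : Type} [Fintype σ] {K : Type} [Field K] [Algebra ℂ K]
    (g : MvPolynomial σ ℂ →ₐ[ℂ] K) (F : MvPolynomial σ ℂ) :
    KaehlerDifferential.D ℂ K (g F) =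
      ∑ i, g (pderiv i F) • KaehlerDifferential.D ℂ K (g (X i)) := by
  classical
  induction F using MvPolynomial.induction_on with
  | C a =>
    have : g (C a) = algebraMap ℂ K a := g.commutes a
    simp [this]
  | add p q hp hq => simp [hp, hq, add_smul, Finset.sum_add_distrib]
  | mul_X p j h =>
    simp only [map_mul, Derivation.leibniz, h, pderiv_X, map_add, smul_eq_mul, add_smul,
      Finset.sum_add_distrib, mul_smul, Finset.smul_sum]
    congr 1
    symm
    refine (Finset.sum_eq_single j ?_ ?_).trans ?_
    · intro b _ hb
      rw [Pi.single_apply, if_neg hb.symm]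
      simp
    · simp
    · simp

lemma prime_dichotomy {n d : ℕ} (hd : d ≠ 0) (G : MvPolynomial (XS n) ℂ)
    (hG : IsWeightedHomogeneous (wtx n) G d)
    (p : Ideal (MvPolynomial (XS n) ℂ)) [p.IsPrime]
    (hp : ∀ i : Fin n, pderiv (Sum.inl i) G ∈ p) :
    pderiv (Sum.inr ()) G ∈ p ∨ ∃ c : ℂ, X (Sum.inr ()) - C c ∈ p := by
  have hGp : G ∈ p := by
    have e := hG.sum_weight_X_mul_pderiv
    have h1 : d • G ∈ p := by
      rw [← e]
      refine p.sum_mem fun i _ => ?_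
      rcases i with i | i
      · exact p.smul_of_tower_mem _ (p.mul_mem_left _ (hp i))
      · simp [wtx]
    have h2 : C ((d:ℂ)⁻¹) * (d • G) = G := by
      rw [nsmul_eq_mul, ← mul_assoc, ← map_natCast (C : ℂ →+* MvPolynomial (XS n) ℂ), ← C_mul,
        inv_mul_cancel₀ (by exact_mod_cast hd)]
      simp
    rw [← h2]; exact p.mul_mem_left _ h1
  let B := MvPolynomial (XS n) ℂ ⧸ p
  let K := FractionRing B
  let g : MvPolynomial (XS n) ℂ →ₐ[ℂ] K :=
    (IsScalarTower.toAlgHom ℂ B K).comp (Ideal.Quotient.mkₐ ℂ p)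
  have hg : ∀ F, g F = 0 ↔ F ∈ p := by
    intro F
    change algebraMap B K (Ideal.Quotient.mk p F) = 0 ↔ _
    rw [map_eq_zero_iff _ (IsFractionRing.injective B K), Ideal.Quotient.eq_zero_iff_mem]
  have : Algebra.EssFiniteType ℂ B := inferInstance
  have : Algebra.EssFiniteType B K := Algebra.EssFiniteType.of_isLocalization _ (nonZeroDivisors B)
  have : Algebra.EssFiniteType ℂ K := Algebra.EssFiniteType.comp ℂ B K
  have h := derivation_expand g G
  rw [(hg G).2 hGp, Fintype.sum_sum_type] at h
  simp only [map_zero, (hg _).2 (hp _), zero_smul, Finset.sum_const_zero, zero_add,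
    Finset.univ_unique, Finset.sum_singleton] at h
  rcases smul_eq_zero.mp h.symm with h | h
  · exact Or.inl ((hg _).1 h)
  · right
    have ha := isAlgebraic_of_D_eq_zero _ h
    have hint := ha.isIntegral
    obtain ⟨c, hc⟩ := minpoly.mem_range_of_degree_eq_one ℂ (g (X (Sum.inr ())))
      (IsAlgClosed.degree_eq_one_of_irreducible ℂ (minpoly.irreducible hint))
    refine ⟨c, (hg _).1 ?_⟩
    have : g (C c) = algebraMap ℂ K c := g.commutes c
    rw [map_sub, this, hc]
    exact sub_self _

lemma eval_scale {n m : ℕ} (F : MvPolynomial (XS n) ℂ)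
    (hF : IsWeightedHomogeneous (wtx n) F m) (c s : ℂ) (x : Fin n → ℂ) :
    eval (evA (c • x) s) F = c ^ m * eval (evA x s) F := by
  rw [eval_eq', eval_eq', Finset.mul_sum]
  refine Finset.sum_congr rfl fun e he => ?_
  have hw := hF (mem_support_iff.mp he)
  rw [Finsupp.weight_apply, Finsupp.sum_fintype _ _ (by simp), Fintype.sum_sum_type] at hw
  simp [wtx] at hw
  rw [Fintype.prod_sum_type, Fintype.prod_sum_type]
  simp only [evA, Sum.elim_inl, Sum.elim_inr, Pi.smul_apply, smul_eq_mul, mul_pow,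
    Finset.prod_mul_distrib, Finset.prod_pow_eq_pow_sum, hw]
  ring

lemma WCond_of_fiber {n d : ℕ} (P : MvPolynomial (XS n) ℂ) (u : HV n → ℂ) (s t : ℂ)
    (hd : d ≠ 0)
    (hu : u (Sum.inr ()) = 0) (h : FiberDerivsVanish d P u s t) :
    WCond d P (fun i => u (Sum.inl i)) s := by
  intro i
  have h1 := h.1 i
  have hemb : ∀ Q : MvPolynomial (XS n) ℂ,
      aeval (embT (n := n)) Q = rename (Sum.map id (fun _ => (1 : Fin 3))) Q := by
    intro Q
    have : (aeval (embT (n := n)) : MvPolynomial (XS n) ℂ →ₐ[ℂ] _) =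
      rename (Sum.map id (fun _ => (1 : Fin 3))) := by
      ext j
      rcases j with j | j <;> simp [embT]
    rw [this]
  have hinj : Function.Injective (Sum.map (id : Fin n → Fin n) (fun _ : Unit => (1 : Fin 3))) :=
    Function.injective_id.sumMap (fun _ _ _ => rfl)
  have hpd : ∀ Q : MvPolynomial (XS n) ℂ, pderiv (Sum.inl i)
      (rename (Sum.map (id : Fin n → Fin n) (fun _ : Unit => (1 : Fin 3))) Q) =
      rename (Sum.map id (fun _ => 1)) (pderiv (Sum.inl i) Q) := fun Q =>
    pderiv_rename hinj (Sum.inl i) Q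
  have hcomp : evT u s t ∘ (Sum.map (id : Fin n → Fin n) (fun _ : Unit => (1 : Fin 3)))
      = evA (fun i => u (Sum.inl i)) s := by
    funext j
    rcases j with j | j <;> simp [evT, evA]
  have hx0 : evT u s t (Sum.inr 0) = 0 := by simp [evT, hu]
  simp only [FY, hemb, map_sub, map_sum, Derivation.leibniz, Derivation.leibniz_pow, hpd,
    smul_eq_mul, map_add, map_mul, map_pow, eval_X, eval_rename, hcomp, hx0] at h1
  rw [Finset.sum_range_succ, Finset.sum_eq_zero] at h1
  · simpa [pderiv_X, hd] using h1
  · intro q hq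
    have := Finset.mem_range.mp hq
    simp [pderiv_X, zero_pow (show d - q ≠ 0 by omega)]

lemma eventually_prime {n d : ℕ} (hd : d ≠ 0) (G : MvPolynomial (XS n) ℂ)
    (hG : IsWeightedHomogeneous (wtx n) G d) :
    ∀ᶠ s : ℂ in 𝓝 0, s ≠ 0 → ∀ x : Fin n → ℂ,
      (∀ i : Fin n, eval (evA x s) (pderiv (Sum.inl i) G) = 0) →
      eval (evA x s) (pderiv (Sum.inr ()) G) = 0 := by
  let I : Ideal (MvPolynomial (XS n) ℂ) :=
    Ideal.span (Set.range fun i : Fin n => pderiv (Sum.inl i) G)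
  have hfin : I.minimalPrimes.Finite := I.finite_minimalPrimes_of_isNoetherianRing
  have key : ∀ᶠ s : ℂ in 𝓝 0, ∀ p ∈ I.minimalPrimes, s ≠ 0 → ∀ x : Fin n → ℂ,
      p ≤ RingHom.ker (eval (evA x s)) → eval (evA x s) (pderiv (Sum.inr ()) G) = 0 := by
    rw [Filter.eventually_all_finite hfin]
    intro p hp
    have : p.IsPrime := hp.1.1
    rcases prime_dichotomy hd G hG p
      (fun i => hp.1.2 (Ideal.subset_span ⟨i, rfl⟩)) with h | ⟨c, h⟩
    · exact Filter.Eventually.of_forall fun s _ x hx => hx h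
    · have hsc : ∀ (s : ℂ) (x : Fin n → ℂ), p ≤ RingHom.ker (eval (evA x s)) → s = c := by
        intro s x hx
        have := hx h
        rw [RingHom.mem_ker] at this
        simpa [evA, sub_eq_zero] using this
      by_cases hc : c = 0
      · exact Filter.Eventually.of_forall fun s hs x hx => absurd ((hsc s x hx).trans hc) hs
      · have : ∀ᶠ s : ℂ in 𝓝 0, s ≠ c := isOpen_ne.mem_nhds (Ne.symm hc)
        filter_upwards [this] with s hs _ x hx
        exact absurd (hsc s x hx) hs
  filter_upwards [key] with s hs hs0 x hx
  have hle : I ≤ RingHom.ker (eval (evA x s)) := by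
    rw [Ideal.span_le]
    rintro _ ⟨i, rfl⟩
    exact hx i
  have : (RingHom.ker (eval (evA x s))).IsPrime := RingHom.ker_isPrime _
  obtain ⟨p, hp, hpl⟩ := Ideal.exists_minimalPrimes_le hle
  exact hs p hp hs0 x hpl

lemma eventually_compact {n d : ℕ} (P : MvPolynomial (XS n) ℂ)
    (hphi : ¬ ∃ x : Fin n → ℂ, x ≠ 0 ∧ WCond d P x 0 ∧ PhiCond d P x) :
    ∀ᶠ s : ℂ in 𝓝 0, ∀ x ∈ Metric.sphere (0 : Fin n → ℂ) 1,
      ¬ (WCond d P x s ∧ eval (evA x s) (pderiv (Sum.inr ()) (xpart P d)) = 0) := by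
  refine (isCompact_sphere (0 : Fin n → ℂ) 1).eventually_forall_of_forall_eventually ?_
  intro y hy
  have hy0 : y ≠ 0 := by
    rintro rfl
    simp at hy
  have hcont : ∀ F : MvPolynomial (XS n) ℂ,
      Continuous fun z : ℂ × (Fin n → ℂ) => eval (evA z.2 z.1) F := by
    intro F
    refine (MvPolynomial.continuous_eval F).comp (continuous_pi fun j => ?_)
    rcases j with j | j
    · exact (continuous_apply j).comp continuous_snd
    · exact continuous_fst
  by_cases hW : WCond d P y 0
  · have hne : eval (evA y 0) (pderiv (Sum.inr ()) (xpart P d)) ≠ 0 :=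
      fun h => hphi ⟨y, hy0, hW, h⟩
    filter_upwards [(hcont _).continuousAt.eventually_ne (x := ((0 : ℂ), y)) hne] with z hz h
    exact hz h.2
  · obtain ⟨i, hi⟩ := not_forall.mp hW
    filter_upwards [(hcont _).continuousAt.eventually_ne (x := ((0 : ℂ), y)) hi] with z hz h
    exact hz (h.1 i)

lemma main_W {n d : ℕ} (hd : 2 ≤ d) (P : MvPolynomial (XS n) ℂ)
    (hphi : ¬ ∃ x : Fin n → ℂ, x ≠ 0 ∧ WCond d P x 0 ∧ PhiCond d P x) :
    ∃ ε > (0:ℝ), ∀ s : ℂ, 0 < ‖s‖ → ‖s‖ < ε → ∀ v : Fin n → ℂ, v ≠ 0 → ¬ WCond d P v s := by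
  have hG : IsWeightedHomogeneous (wtx n) (xpart P d) d :=
    weightedHomogeneousComponent_isWeightedHomogeneous _ _
  have hev := (eventually_prime (by omega) _ hG).and (eventually_compact P hphi)
  obtain ⟨ε, hε, h⟩ := Metric.eventually_nhds_iff.mp hev
  refine ⟨ε, hε, fun s hs0 hs v hv hW => ?_⟩
  obtain ⟨h1, h2⟩ := h (show dist s 0 < ε by simpa using hs)
  have hW' : WCond d P (((‖v‖ : ℂ)⁻¹) • v) s := by
    intro i
    have hi : IsWeightedHomogeneous (wtx n) (pderiv (Sum.inl i) (xpart P d)) (d - 1) :=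
      hG.pderiv (by simp [wtx]; omega)
    rw [eval_scale _ hi, hW i, mul_zero]
  refine h2 (((‖v‖ : ℂ)⁻¹) • v) ?_ ⟨hW', h1 (norm_pos_iff.mp hs0) _ hW'⟩
  have : ‖v‖ ≠ 0 := norm_ne_zero_iff.mpr hv
  simp [norm_smul, this]

end AuxProof

/-- If `W₀ ∩ {φ_d = 0} = ∅` then, for all `0 < |s| < ε` and all `t`,
the projective closure `Y_{s,t}` has no singular point on `H^∞` and the hypersurface
`Y^∞_{s,t} = {P_d(·,s) = 0} ⊂ ℙ^{n-1}` is nonsingular; equivalently `Σ_s = ∅` and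
`W_s = ∅`. -/
theorem stmt4 {n d : ℕ} (hn : 2 ≤ n) (hd : 2 ≤ d) (P : MvPolynomial (XS n) ℂ)
    (hdeg : ∃ ε > (0:ℝ), ∀ s : ℂ, ‖s‖ < ε → DegXAt d P s)
    (hfisi : FISIat d P 0)
    (hphi : ¬ ∃ x : Fin n → ℂ, x ≠ 0 ∧ WCond d P x 0 ∧ PhiCond d P x) :
    ∃ ε > (0:ℝ), ∀ s : ℂ, 0 < ‖s‖ → ‖s‖ < ε →
      (∀ t : ℂ, ∀ (u : HV n → ℂ), u ≠ 0 → u (Sum.inr ()) = 0 →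
        ¬ (OnY d P u s t ∧ FiberDerivsVanish d P u s t)) ∧
      (∀ v : Fin n → ℂ, v ≠ 0 → ¬ WCond d P v s) ∧
      (∀ v : Fin n → ℂ, v ≠ 0 → ¬ SCond d P v s) := by
  obtain ⟨ε, hε, h⟩ := main_W hd P hphi
  refine ⟨ε, hε, fun s hs0 hs => ⟨?_, h s hs0 hs, fun v hv hS => h s hs0 hs v hv hS.1⟩⟩
  rintro t u hu hu0 ⟨-, hf⟩
  refine h s hs0 hs (fun i => u (Sum.inl i)) ?_ (WCond_of_fiber P u s t (by omega) hu0 hf)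
  intro h0
  apply hu
  funext j
  rcases j with j | j
  · exact congrFun h0 j
  · exact hu0
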